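/- Let n ≥ 1, let a ∈ ℤⁿ have all entries positive, let σ ∈ {−1,1}ⁿ satisfy ⟨σ, a⟩ > 0, and let ε, δ satisfy 0 < ε < δ and δ·‖a‖₁ < 1. Then Vol( C(δ·a, 1) ∩ C_σ(0, 1+ε) ∖ C(0,1) ) ≥ (ε/(n−1)!) · (1 − δ·‖a‖₁)^{n−1}. -/

import Mathlib

open MeasureTheory

/-- The cross-polytope (closed `L¹`-ball) of radius `r` centered at `c` in `ℝⁿ`. -/
def crossPolytope {n : ℕ} (c : Fin n → ℝ) (r : ℝ) : Set (Fin n → ℝ) :=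
  {x | ∑ i, |x i - c i| ≤ r}

/-- The orthant piece `C_σ(c,r)` of the cross-polytope `C(c,r)`. -/
def crossPolytopeOrthant {n : ℕ} (σ : Fin n → ℝ) (c : Fin n → ℝ) (r : ℝ) :
    Set (Fin n → ℝ) :=
  {x ∈ crossPolytope c r | ∀ i, 0 ≤ σ i * (x i - c i)}

theorem cp_vol {n : ℕ} (hn : 1 ≤ n) (r : ℝ) (hr : 0 ≤ r) :
    volume (crossPolytope (0 : Fin n → ℝ) r) = ENNReal.ofReal ((2 * r) ^ n / (n.factorial : ℝ)) := by
  have : Nonempty (Fin n) := ⟨⟨0, hn⟩⟩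
  have h := MeasureTheory.volume_sum_rpow_le (ι := Fin n) (p := 1) le_rfl r
  have e : crossPolytope (0 : Fin n → ℝ) r = {x : Fin n → ℝ | (∑ i, |x i| ^ (1:ℝ)) ^ (1 / (1:ℝ)) ≤ r} := by
    ext x; simp [crossPolytope]
  rw [e, h, ← ENNReal.ofReal_pow hr, ← ENNReal.ofReal_mul (by positivity)]
  congr 1
  have g : Real.Gamma (1 / 1 + 1) = 1 := by norm_num
  have g2 : Real.Gamma ((Fintype.card (Fin n) : ℝ) / 1 + 1) = n.factorial := by
    simp [Real.Gamma_nat_eq_factorial]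
  rw [g, g2, mul_pow]; simp; ring

theorem cp_closed {n : ℕ} (c : Fin n → ℝ) (r : ℝ) : IsClosed (crossPolytope c r) := by
  unfold crossPolytope
  exact isClosed_le (by fun_prop) (by fun_prop)

theorem bern (n : ℕ) (t ε : ℝ) (ht : 0 ≤ t) (hε : 0 ≤ ε) :
    t ^ (n+1) + (n + 1) * ε * t ^ n ≤ (t + ε) ^ (n+1) := by
  induction n with
  | zero => simp
  | succ k ih =>
    have h1 := mul_le_mul_of_nonneg_right ih (add_nonneg ht hε)
    have h2 : 0 ≤ (k + 1) * ε * t ^ k * ε := by positivity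
    rw [pow_succ (t + ε)]
    refine le_trans ?_ h1
    push_cast
    ring_nf at h2 ⊢
    linarith

def sg (b : Bool) : ℝ := if b then 1 else -1

theorem mp_flip {n : ℕ} (τ : Fin n → Bool) (c : Fin n → ℝ) :
    MeasurePreserving (fun x : Fin n → ℝ => fun i => sg (τ i) * x i + c i) volume volume := by
  refine volume_preserving_pi (f := fun i (y : ℝ) => sg (τ i) * y + c i) fun i => ?_
  have h1 : MeasurePreserving (fun y : ℝ => sg (τ i) * y) volume volume := by
    cases τ i
    · simpa [sg] using Measure.measurePreserving_neg (volume : Measure ℝ)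
    · simp only [sg, if_true, one_mul]
      exact MeasurePreserving.id (volume : Measure ℝ)
  exact (measurePreserving_add_right volume (c i)).comp h1

theorem stmt19 (n : ℕ) (hn : 1 ≤ n) (a : Fin n → ℤ) (hapos : ∀ i, 0 < a i)
    (σ : Fin n → ℝ) (hσ : ∀ i, σ i = 1 ∨ σ i = -1)
    (hσa : 0 < ∑ i, σ i * (a i : ℝ))
    (ε δ : ℝ) (hε : 0 < ε) (hεδ : ε < δ)
    (hδa : δ * ∑ i, |(a i : ℝ)| < 1) :
    ε / ((n - 1).factorial : ℝ) * (1 - δ * ∑ i, |(a i : ℝ)|) ^ (n - 1)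
      ≤ (volume ((crossPolytope (δ • fun i => (a i : ℝ)) 1 ∩
          crossPolytopeOrthant σ (0 : Fin n → ℝ) (1 + ε)) \
          crossPolytope (0 : Fin n → ℝ) 1)).toReal := by
  have hδ : 0 < δ := hε.trans hεδ
  have hap : ∀ i, (0:ℝ) < a i := fun i => by exact_mod_cast hapos i
  set t : ℝ := 1 - δ * ∑ i, |(a i : ℝ)| with ht
  have ht0 : 0 < t := by linarith
  -- integrality
  have hone : 1 ≤ ∑ i, σ i * (a i : ℝ) := by
    have : ∃ s : Fin n → ℤ, ∀ i, σ i = s i := by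
      refine ⟨fun i => if σ i = 1 then 1 else -1, fun i => ?_⟩
      rcases hσ i with h | h <;> simp [h] <;> norm_num
    obtain ⟨s, hs⟩ := this
    simp only [hs] at hσa ⊢
    have : 0 < ∑ i, s i * a i := by exact_mod_cast hσa
    have : 1 ≤ ∑ i, s i * a i := this
    exact_mod_cast this
  set T := ((crossPolytope (δ • fun i => (a i : ℝ)) 1 ∩
          crossPolytopeOrthant σ (0 : Fin n → ℝ) (1 + ε)) \
          crossPolytope (0 : Fin n → ℝ) 1) with hT
  have hTm : MeasurableSet T := by
    refine ((cp_closed _ _).measurableSet.inter ?_).diff (cp_closed _ _).measurableSet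
    refine (cp_closed _ _).measurableSet.inter ?_
    refine IsClosed.measurableSet ?_
    have : IsClosed {x : Fin n → ℝ | ∀ i, 0 ≤ σ i * (x i - (0 : Fin n → ℝ) i)} := by
      rw [Set.setOf_forall]
      exact isClosed_iInter fun i => isClosed_le (by fun_prop) (by fun_prop)
    exact this
  have hTfin : volume T ≠ ⊤ := by
    have hsub : T ⊆ crossPolytope (0 : Fin n → ℝ) (1+ε) := fun x hx => hx.1.2.1
    refine ne_top_of_le_ne_top ?_ (measure_mono hsub)
    rw [cp_vol hn _ (by positivity)]
    exact ENNReal.ofReal_ne_top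
  let φ : (Fin n → Bool) → (Fin n → ℝ) → (Fin n → ℝ) :=
    fun τ x i => sg (τ i) * x i + σ i * (δ * a i)
  have hcov : crossPolytope (0 : Fin n → ℝ) (t+ε) \ crossPolytope (0 : Fin n → ℝ) t
      ⊆ ⋃ τ, φ τ ⁻¹' T := by
    rintro x ⟨hx1, hx2⟩
    simp only [crossPolytope, Set.mem_setOf_eq, Pi.zero_apply, sub_zero, not_le] at hx1 hx2
    rw [Set.mem_iUnion]
    have : ∃ τ : Fin n → Bool, ∀ i, sg (τ i) * x i = σ i * |x i| := by
      have : ∀ i, ∃ b : Bool, sg b * x i = σ i * |x i| := by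
        intro i
        rcases hσ i with h | h <;> rcases abs_cases (x i) with h' | h' <;> rw [h, h'.1]
        · exact ⟨true, by simp [sg]⟩
        · exact ⟨false, by simp [sg]⟩
        · exact ⟨false, by simp [sg]⟩
        · exact ⟨true, by simp [sg]⟩
      choose τ h using this
      exact ⟨τ, h⟩
    obtain ⟨τ, hτ⟩ := this
    refine ⟨τ, ?_⟩
    have hφ : ∀ i, φ τ x i = σ i * (|x i| + δ * a i) := fun i => by
      simp only [φ, hτ]; ring
    have hp : ∀ i, 0 ≤ |x i| + δ * a i := fun i => by
      have := hap i; positivity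
    have habs : ∀ i, |φ τ x i| = |x i| + δ * |(a i:ℝ)| := fun i => by
      rw [hφ, abs_mul, abs_of_nonneg (hp i), abs_of_pos (hap i)]
      rcases hσ i with h | h <;> simp [h]
    have hS : ∑ i, |φ τ x i| = ∑ i, |x i| + (1 - t) := by
      simp only [habs, Finset.sum_add_distrib, ← Finset.mul_sum]; rw [ht]; ring
    refine ⟨⟨?_, ?_, ?_⟩, ?_⟩
    · have : ∀ i, |φ τ x i - (δ • fun i => (a i : ℝ)) i| = |φ τ x i| - δ * (σ i * a i) := by
        intro i
        rw [habs, hφ, abs_of_pos (hap i)]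
        have h0 := hap i
        have h1 : 0 < δ * a i := by positivity
        have h2 := abs_nonneg (x i)
        simp only [Pi.smul_apply, smul_eq_mul]
        rcases hσ i with h | h <;> rw [h]
        · rw [abs_of_nonneg (by linarith)]; ring
        · rw [abs_of_nonpos (by linarith)]; ring
      simp only [crossPolytope, Set.mem_setOf_eq, this, Finset.sum_sub_distrib, ← Finset.mul_sum, hS]
      nlinarith
    · simp only [crossPolytope, Set.mem_setOf_eq, Pi.zero_apply, sub_zero, hS]
      linarith
    · intro i
      rw [hφ, Pi.zero_apply, sub_zero, ← mul_assoc]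
      rcases hσ i with h | h <;> rw [h] <;> linarith [hp i]
    · simp only [crossPolytope, Set.mem_setOf_eq, Pi.zero_apply, sub_zero, hS]
      linarith
  have hle : volume (crossPolytope (0 : Fin n → ℝ) (t+ε) \ crossPolytope (0 : Fin n → ℝ) t)
      ≤ 2 ^ n * volume T := by
    refine (measure_mono hcov).trans ((measure_iUnion_le _).trans ?_)
    have : ∀ τ, volume (φ τ ⁻¹' T) = volume T := fun τ =>
      (mp_flip τ (fun i => σ i * (δ * a i))).measure_preimage hTm.nullMeasurableSet
    simp [this]
  have hss : crossPolytope (0 : Fin n → ℝ) t ⊆ crossPolytope (0 : Fin n → ℝ) (t+ε) :=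
    fun x hx => le_trans (show _ ≤ t from hx) (by linarith)
  rw [measure_sdiff hss (cp_closed _ _).measurableSet.nullMeasurableSet
    (by rw [cp_vol hn _ ht0.le]; exact ENNReal.ofReal_ne_top), cp_vol hn _ ht0.le,
    cp_vol hn _ (by positivity), ← ENNReal.ofReal_sub _ (by positivity)] at hle
  have hle2 := ENNReal.toReal_mono (ENNReal.mul_ne_top (by simp) hTfin) hle
  rw [ENNReal.toReal_mul] at hle2
  have hle3 := (le_max_left _ _).trans (ENNReal.toReal_ofReal' ▸ hle2)
  simp only [ENNReal.toReal_pow, ENNReal.toReal_ofNat, mul_pow] at hle3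
  obtain ⟨m, rfl⟩ : ∃ m, n = m + 1 := ⟨n - 1, by omega⟩
  have hb := bern m t ε ht0.le hε.le
  simp only [Nat.add_sub_cancel]
  have h2 : (0:ℝ) < 2 ^ (m+1) := by positivity
  have hle4 : ((t+ε)^(m+1) - t^(m+1)) / ((m+1).factorial : ℝ) ≤ (volume T).toReal := by
    refine le_of_mul_le_mul_left ?_ h2
    refine le_trans (le_of_eq ?_) hle3
    ring
  refine le_trans ?_ hle4
  rw [le_div_iff₀ (by positivity), Nat.factorial_succ]
  push_cast
  have hf : (0:ℝ) < m.factorial := by positivity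
  have : ε / (m.factorial : ℝ) * t ^ m * ((m + 1) * m.factorial) = (m+1) * ε * t^m := by
    field_simp
  rw [this]; linarith
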